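/- Let Λ > 0 and 0 < R < 1/(2Λ). Set A = 8π²R^{3/2}/(1 + 2ΛR)² and 𝒥 = πR^{3/2}√(1 − 2ΛR)/(1 + 2ΛR)³. Then 𝒥 > 0 and Λ³A⁶/(2¹⁰π⁶𝒥²) = (A·√(A² + 512π²𝒥²) − A² − 128π²𝒥²)³ / (A − √(A² + 512π²𝒥²))⁴. -/

import Mathlib

open Real

/-- The extreme CCLP black hole with positive cosmological constant, equal angular momenta
and vanishing charge saturates the area–angular momentum relation of Theorem 2.4(a). -/
theorem stmt7 (Λ R A J : ℝ) (hΛ : 0 < Λ) (hR1 : 0 < R) (hR2 : R < 1 / (2 * Λ))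
    (hA : A = 8 * π ^ 2 * R ^ ((3 : ℝ) / 2) / (1 + 2 * Λ * R) ^ 2)
    (hJ : J = π * R ^ ((3 : ℝ) / 2) * Real.sqrt (1 - 2 * Λ * R) / (1 + 2 * Λ * R) ^ 3) :
    0 < J ∧
      Λ ^ 3 * A ^ 6 / (2 ^ 10 * π ^ 6 * J ^ 2) =
        (A * Real.sqrt (A ^ 2 + 512 * π ^ 2 * J ^ 2) - A ^ 2 - 128 * π ^ 2 * J ^ 2) ^ 3 /
          (A - Real.sqrt (A ^ 2 + 512 * π ^ 2 * J ^ 2)) ^ 4 := by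
  have hx : 0 < 1 - 2 * Λ * R := by
    rw [lt_div_iff₀ (by positivity)] at hR2
    linarith
  have hs : 0 < 1 + 2 * Λ * R := by positivity
  have hP : 0 < R ^ ((3 : ℝ) / 2) := Real.rpow_pos_of_pos hR1 _
  have hP2 : (R ^ ((3 : ℝ) / 2)) ^ 2 = R ^ 3 := by
    rw [← Real.rpow_natCast, ← Real.rpow_mul hR1.le, ← Real.rpow_natCast]
    norm_num
  generalize R ^ ((3 : ℝ) / 2) = P at hA hJ hP hP2
  have hJpos : 0 < J := by
    rw [hJ]
    positivity
  have hJ2 : J ^ 2 = π ^ 2 * P ^ 2 * (1 - 2 * Λ * R) / (1 + 2 * Λ * R) ^ 6 := by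
    rw [hJ, div_pow, mul_pow, Real.sq_sqrt hx.le]
    ring
  have hroot : Real.sqrt (A ^ 2 + 512 * π ^ 2 * J ^ 2) =
      8 * π ^ 2 * P * (3 - 2 * Λ * R) / (1 + 2 * Λ * R) ^ 3 := by
    have h3 : 0 < 3 - 2 * Λ * R := by linarith
    rw [Real.sqrt_eq_iff_mul_self_eq (by positivity) (by positivity), hJ2, hA]
    field_simp
    ring
  have hden : A - Real.sqrt (A ^ 2 + 512 * π ^ 2 * J ^ 2) =
      -(16 * π ^ 2 * P * (1 - 2 * Λ * R) / (1 + 2 * Λ * R) ^ 3) := by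
    rw [hroot, hA]
    field_simp
    ring
  have hnum : A * Real.sqrt (A ^ 2 + 512 * π ^ 2 * J ^ 2) - A ^ 2 - 128 * π ^ 2 * J ^ 2 =
      128 * π ^ 4 * P ^ 2 * (1 - 2 * Λ * R) * (2 * Λ * R) / (1 + 2 * Λ * R) ^ 6 := by
    rw [hroot, hJ2, hA]
    field_simp
    ring
  refine ⟨hJpos, ?_⟩
  rw [hnum, hden, hJ2, hA]
  generalize hu : 1 - 2 * Λ * R = u at hx ⊢
  generalize hv : 1 + 2 * Λ * R = v at hs ⊢
  have hlhs : Λ ^ 3 * (8 * π ^ 2 * P / v ^ 2) ^ 6 /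
      (2 ^ 10 * π ^ 6 * (π ^ 2 * P ^ 2 * u / v ^ 6)) =
      256 * π ^ 4 * Λ ^ 3 * P ^ 2 * P ^ 2 / (v ^ 6 * u) := by
    field_simp
    norm_num
  have hrhs : (128 * π ^ 4 * P ^ 2 * u * (2 * Λ * R) / v ^ 6) ^ 3 /
      (-(16 * π ^ 2 * P * u / v ^ 3)) ^ 4 =
      256 * π ^ 4 * Λ ^ 3 * P ^ 2 * R ^ 3 / (v ^ 6 * u) := by
    rw [Even.neg_pow (by decide)]
    field_simp
    norm_num
  rw [hlhs, hrhs, hP2]
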